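/- arXiv:2504.14490 — 5 statements merged into one kernel-verified Lean document; each statement's English description precedes it below -/
import Mathlib

section
/- Let p be a prime and let N, n, a, k be natural numbers with N > 0, 0 < a < p, and N + n·a ≤ p^k. Then the p-adic valuation of the product ∏_{i=0}^{n} (N + i·a) satisfies v_p(∏_{i=0}^{n} (N + i·a)) ≤ k + n/(p−1), as an inequality of rational numbers. -/
/-- Among `n + 1` consecutive terms of an arithmetic progression whose common difference is coprime
to `q`, at most `n / q + 1` are divisible by `q`. -/
lemma card_filter_dvd_add_mul_le {q a : ℕ} (hqa : Nat.Coprime q a) (N n : ℕ) :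
    ((Finset.range (n + 1)).filter fun i => q ∣ N + i * a).card ≤ n / q + 1 := by
  rw [← Finset.card_range (n / q + 1)]
  refine Finset.card_le_card_of_injOn (· / q) (fun i hi => ?_) fun i hi j hj hij => ?_
  · simp only [Finset.coe_filter, Set.mem_ofPred_eq, Finset.mem_range] at hi
    simp only [Finset.coe_range, Set.mem_Iio]
    exact Nat.lt_succ_of_le (Nat.div_le_div_right (Nat.le_of_lt_succ hi.1))
  · simp only [Finset.coe_filter, Set.mem_ofPred_eq] at hi hj
    have hmod : N + i * a ≡ N + j * a [MOD q] :=
      ((Nat.modEq_zero_iff_dvd).2 hi.2).trans ((Nat.modEq_zero_iff_dvd).2 hj.2).symm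
    have hij' : i % q = j % q :=
      Nat.ModEq.cancel_right_of_coprime hqa (Nat.ModEq.add_left_cancel' N hmod)
    rw [← Nat.div_add_mod i q, ← Nat.div_add_mod j q, hij', show i / q = j / q from hij]

/-- The valuation of a product of terms of an arithmetic progression bounded by `p ^ k` exceeds
that of `n !` by at most `k`. -/
lemma padicValNat_prod_add_mul_le {p : ℕ} [hp : Fact p.Prime] {N n a k : ℕ} (hN : 0 < N)
    (ha0 : 0 < a) (hap : a < p) (hbound : N + n * a ≤ p ^ k) :
    padicValNat p (∏ i ∈ Finset.range (n + 1), (N + i * a)) ≤ k + padicValNat p n.factorial := by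
  have hpa : p.Coprime a := Nat.coprime_of_lt_prime ha0.ne' hap hp.out
  have hnlog : Nat.log p n < k + 1 := by
    refine Nat.lt_succ_of_le ?_
    rw [← Nat.log_pow hp.out.one_lt k]
    exact Nat.log_mono_right ((Nat.le_mul_of_pos_right n ha0).trans (by omega))
  have hval : ∀ i ∈ Finset.range (n + 1), (N + i * a).factorization p =
      ((Finset.Ico 1 (k + 1)).filter fun j => p ^ j ∣ N + i * a).card := by
    intro i hi
    have hle : i * a ≤ n * a := Nat.mul_le_mul_right a (Nat.le_of_lt_succ (Finset.mem_range.1 hi))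
    exact Nat.factorization_eq_card_pow_dvd_of_lt hp.out (by omega)
      ((show N + i * a ≤ p ^ k by omega).trans_lt (Nat.pow_lt_pow_succ hp.out.one_lt))
  rw [padicValNat_factorial hnlog, ← Nat.factorization_def _ hp.out,
    Nat.factorization_prod fun i _ => by omega, Finset.sum_apply', Finset.sum_congr rfl hval]
  calc _ = ∑ j ∈ Finset.Ico 1 (k + 1),
        ((Finset.range (n + 1)).filter fun i => p ^ j ∣ N + i * a).card :=
        Finset.sum_card_bipartiteAbove_eq_sum_card_bipartiteBelow fun i j => p ^ j ∣ N + i * a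
    _ ≤ ∑ j ∈ Finset.Ico 1 (k + 1), (n / p ^ j + 1) := Finset.sum_le_sum fun j _ =>
        card_filter_dvd_add_mul_le (hpa.pow_left j) N n
    _ = _ := by simp [Finset.sum_add_distrib, add_comm]

/-- Lemma 4.8 ("factorial pval") of the paper: if `N > 0`, `0 < a < p` and
`N + n·a ≤ p^k`, then `v_p(∏_{i=0}^{n} (N + i·a)) ≤ k + n/(p-1)`. -/
theorem stmt0 (p : ℕ) (hp : p.Prime) (N n a k : ℕ) (hN : 0 < N)
    (ha0 : 0 < a) (hap : a < p) (hbound : N + n * a ≤ p ^ k) :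
    (padicValNat p (∏ i ∈ Finset.range (n + 1), (N + i * a)) : ℚ)
      ≤ k + n / (p - 1) := by
  have : Fact p.Prime := ⟨hp⟩
  have hfact : (p - 1) * padicValNat p n.factorial ≤ n :=
    (sub_one_mul_padicValNat_factorial n).trans_le (Nat.sub_le _ _)
  have hfactQ : (padicValNat p n.factorial : ℚ) ≤ n / (p - 1) := by
    rw [le_div_iff₀' (sub_pos.2 (by exact_mod_cast hp.one_lt))]
    have := (Nat.cast_le (α := ℚ)).2 hfact
    rwa [Nat.cast_mul, Nat.cast_sub hp.one_le, Nat.cast_one] at this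
  calc _ ≤ ((k + padicValNat p n.factorial : ℕ) : ℚ) :=
        Nat.cast_le.2 (padicValNat_prod_add_mul_le hN ha0 hap hbound)
    _ ≤ _ := by
        rw [Nat.cast_add]
        gcongr
end

section
/- Let p be a prime and let N, n, a be natural numbers with N > 0 and 0 < a < p. Let n₀ ∈ {0,…,n} be an index at which v_p(N + i·a) attains its maximum over i ∈ {0,…,n}. Then v_p(∏_{0 ≤ i ≤ n, i ≠ n₀} (N + i·a)) ≤ n/(p−1), as an inequality of rational numbers. -/
/-- If `p ^ k` divides two terms of an arithmetic progression whose difference `a` is positive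
and less than `p`, then it divides the distance `d` of their indices. -/
lemma padicValNat_le_of_add_mul {p x a d : ℕ} (hp : p.Prime) (hx : 0 < x) (ha0 : 0 < a)
    (hap : a < p) (hd : 0 < d) {k : ℕ} (h₁ : k ≤ padicValNat p x)
    (h₂ : k ≤ padicValNat p (x + d * a)) : k ≤ padicValNat p d := by
  have : Fact p.Prime := ⟨hp⟩
  have hdvd : p ^ k ∣ d * a :=
    (Nat.dvd_add_right ((padicValNat_dvd_iff_le hx.ne').2 h₁)).1
      ((padicValNat_dvd_iff_le (by positivity)).2 h₂)
  have hcop : Nat.Coprime (p ^ k) a :=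
    Nat.Coprime.pow_left k (Nat.coprime_of_lt_prime ha0.ne' hap hp)
  exact (padicValNat_dvd_iff_le hd.ne').1 (hcop.dvd_of_dvd_mul_right hdvd)

lemma padicValNat_prod {ι : Type*} {p : ℕ} [Fact p.Prime] (s : Finset ι) (f : ι → ℕ)
    (hf : ∀ i ∈ s, f i ≠ 0) :
    padicValNat p (∏ i ∈ s, f i) = ∑ i ∈ s, padicValNat p (f i) := by
  classical
  induction s using Finset.induction_on with
  | empty => simp
  | insert i s hi ih =>
    rw [Finset.prod_insert hi, Finset.sum_insert hi, padicValNat.mul (hf i (by simp))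
      (Finset.prod_ne_zero_iff.2 fun j hj => hf j (by simp [hj])),
      ih fun j hj => hf j (by simp [hj])]

lemma sum_padicValNat_succ {p : ℕ} [Fact p.Prime] (m : ℕ) :
    ∑ j ∈ Finset.range m, padicValNat p (j + 1) = padicValNat p m.factorial := by
  rw [← Finset.prod_range_add_one_eq_factorial, padicValNat_prod _ _ (by simp)]

lemma sum_padicValNat_dist {p : ℕ} [Fact p.Prime] (k m : ℕ) :
    ∑ i ∈ Finset.range (k + m + 1), padicValNat p (Nat.dist i k) =
      padicValNat p k.factorial + padicValNat p m.factorial := by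
  rw [show k + m + 1 = k + (m + 1) by ring, Finset.sum_range_add, Finset.sum_range_succ',
    ← sum_padicValNat_succ k, ← sum_padicValNat_succ m, ← Finset.sum_range_reflect _ k]
  have hleft : ∀ i ∈ Finset.range k,
      padicValNat p (Nat.dist (k - 1 - i) k) = padicValNat p (i + 1) := fun i hi => by
    rw [Finset.mem_range] at hi
    congr 1
    unfold Nat.dist
    omega
  have hright : ∀ i, Nat.dist (k + (i + 1)) k = i + 1 := fun i => by
    unfold Nat.dist
    omega
  rw [Finset.sum_congr rfl hleft]
  simp [hright]

/-- Key intermediate claim of the paper's Lemma on valuations of products over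
an arithmetic progression: dropping an index `n₀` at which the `p`-adic
valuation is maximal, the remaining product has valuation at most `n/(p-1)`. -/
theorem stmt1 (p : ℕ) (hp : p.Prime) (N n a n₀ : ℕ) (hN : 0 < N)
    (ha0 : 0 < a) (hap : a < p) (hn₀ : n₀ ≤ n)
    (hmax : ∀ i ≤ n, padicValNat p (N + i * a) ≤ padicValNat p (N + n₀ * a)) :
    (padicValNat p (∏ i ∈ (Finset.range (n + 1)).erase n₀, (N + i * a)) : ℚ)
      ≤ n / (p - 1) := by
  have : Fact p.Prime := ⟨hp⟩
  obtain ⟨m, rfl⟩ := Nat.exists_eq_add_of_le hn₀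
  have hterm : ∀ i ∈ (Finset.range (n₀ + m + 1)).erase n₀,
      padicValNat p (N + i * a) ≤ padicValNat p (Nat.dist i n₀) := fun i hi => by
    obtain ⟨hne, hi⟩ := Finset.mem_erase.1 hi
    have hle := hmax i (Nat.lt_succ_iff.1 (Finset.mem_range.1 hi))
    rcases lt_or_gt_of_ne hne with h | h
    · obtain ⟨d, rfl⟩ := Nat.exists_eq_add_of_le h.le
      rw [show Nat.dist i (i + d) = d by unfold Nat.dist; omega]
      refine padicValNat_le_of_add_mul (x := N + i * a) hp (by omega) ha0 hap (by omega) le_rfl ?_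
      rwa [add_assoc, ← add_mul]
    · obtain ⟨d, rfl⟩ := Nat.exists_eq_add_of_le h.le
      rw [show Nat.dist (n₀ + d) n₀ = d by unfold Nat.dist; omega]
      refine padicValNat_le_of_add_mul (x := N + n₀ * a) hp (by omega) ha0 hap (by omega) hle ?_
      rw [add_assoc, ← add_mul]
  have hval : padicValNat p (∏ i ∈ (Finset.range (n₀ + m + 1)).erase n₀, (N + i * a)) ≤
      padicValNat p n₀.factorial + padicValNat p m.factorial := by
    rw [padicValNat_prod _ _ fun i _ => by omega, ← sum_padicValNat_dist]
    exact (Finset.sum_le_sum hterm).trans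
      (Finset.sum_le_sum_of_subset (Finset.erase_subset _ _))
  have hfac : ∀ k : ℕ, (p - 1) * padicValNat p k.factorial ≤ k := fun k => by
    rw [sub_one_mul_padicValNat_factorial]
    exact Nat.sub_le _ _
  have hmul : (p - 1) * padicValNat p
      (∏ i ∈ (Finset.range (n₀ + m + 1)).erase n₀, (N + i * a)) ≤ n₀ + m :=
    (Nat.mul_le_mul_left _ hval).trans (by
      rw [mul_add]
      exact add_le_add (hfac n₀) (hfac m))
  have hp1 : (0 : ℚ) < p - 1 := sub_pos.2 (by exact_mod_cast hp.one_lt)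
  rw [le_div_iff₀ hp1, mul_comm, ← Nat.cast_pred hp.pos]
  exact_mod_cast hmul
end

section
/- For every natural number n ≥ 1 and every matrix A ∈ M₂(O), there exists a matrix B ∈ M₂(O) such that (1 + pⁿ·B)^p = 1 + p^{n+1}·A. Equivalently, every element of the congruence subgroup 1 + p^{n+1}M₂(O) is the p-th power of an element of 1 + pⁿM₂(O). -/
open Polynomial

/-- `O = ℤ_p[X]/(X² - p)`, the ring of integers of the ramified quadratic
extension `ℚ_p(√p)` of `ℚ_p`. -/
noncomputable abbrev Oram (p : ℕ) [Fact p.Prime] : Type :=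
  AdjoinRoot (X ^ 2 - C (p : ℤ_[p]))

section AdicFixedPoint

variable {R M : Type*} [CommRing R] {I : Ideal R}

theorem SModEq.map_smul_top {N : Type*} [AddCommGroup M] [Module R M] [AddCommGroup N] [Module R N]
    {x y : M} (h : x ≡ y [SMOD (I • ⊤ : Submodule R M)]) (f : M →ₗ[R] N) :
    f x ≡ f y [SMOD (I • ⊤ : Submodule R N)] := by
  refine (h.map f).mono ?_
  rw [Submodule.map_smul'']
  exact smul_mono_right _ le_top

theorem Module.Basis.isPrecomplete {ι : Type*} [Fintype ι] [AddCommGroup M] [Module R M]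
    (b : Module.Basis ι R M) (I : Ideal R) [IsPrecomplete I R] : IsPrecomplete I M where
  prec' f hf := by
    have coord (i : ι) : ∃ l : R, ∀ n, b.coord i (f n) ≡ l [SMOD (I ^ n • ⊤ : Submodule R R)] :=
      IsPrecomplete.prec' _ fun {m n} hmn ↦ 
        (hf hmn).map_smul_top (b.coord i)
    choose l hl using coord
    refine ⟨∑ i, l i • b i, fun n ↦ ?_⟩
    rw [← b.sum_repr (f n)]
    exact SModEq.sum fun i _ ↦ (hl i n).map_smul_top (LinearMap.toSpanSingleton R M (b i))

variable [Ring M] [Algebra R M]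

theorem SModEq.mul_smul_top {x y z w : M} (hxy : x ≡ y [SMOD (I • ⊤ : Submodule R M)])
    (hzw : z ≡ w [SMOD (I • ⊤ : Submodule R M)]) :
    x * z ≡ y * w [SMOD (I • ⊤ : Submodule R M)] := by
  exact (hxy.map_smul_top (LinearMap.mulRight R z)).trans
    (hzw.map_smul_top (LinearMap.mulLeft R y))

theorem SModEq.aeval_smul_top {x y : M} (h : x ≡ y [SMOD (I • ⊤ : Submodule R M)]) (g : R[X]) :
    aeval x g ≡ aeval y g [SMOD (I • ⊤ : Submodule R M)] := by
  have hpow (k : ℕ) : x ^ k ≡ y ^ k [SMOD (I • ⊤ : Submodule R M)] := by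
    induction k with
    | zero => simp
    | succ k ih => simpa only [pow_succ] using ih.mul_smul_top h
  rw [aeval_eq_sum_range, aeval_eq_sum_range]
  exact SModEq.sum fun k _ ↦ (hpow k).smul _

/-- A polynomial map congruent to the identity modulo `I` is surjective on an `I`-adically
complete algebra. -/
theorem exists_add_smul_aeval_eq [IsAdicComplete I M] {a : R} (ha : a ∈ I) (g : R[X]) (A : M) :
    ∃ B : M, B + a • aeval B g = A := by
  let T : M → M := fun B ↦ A - a • aeval B g
  have contract {k : ℕ} {x y : M} (h : x ≡ y [SMOD (I ^ k • ⊤ : Submodule R M)]) :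
      T x ≡ T y [SMOD (I ^ (k + 1) • ⊤ : Submodule R M)] := by
    refine SModEq.rfl.sub ?_
    rw [SModEq.sub_mem, ← smul_sub, pow_succ', Submodule.mul_smul]
    exact Submodule.smul_mem_smul ha (SModEq.sub_mem.mp (h.aeval_smul_top g))
  have cauchy (k d : ℕ) : T^[k] 0 ≡ T^[k + d] 0 [SMOD (I ^ k • ⊤ : Submodule R M)] := by
    induction k with
    | zero => simp [SModEq.sub_mem]
    | succ k ih =>
      rw [Nat.succ_add, Function.iterate_succ_apply', Function.iterate_succ_apply']
      exact contract ih
  obtain ⟨B, hB⟩ := IsPrecomplete.prec (I := I) inferInstance (f := fun k ↦ T^[k] 0)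
    fun {m n} hmn ↦ by
      obtain ⟨d, rfl⟩ := Nat.exists_eq_add_of_le hmn
      exact cauchy m d
  have hfix : T B - B = 0 := IsHausdorff.haus (I := I) inferInstance _ fun n ↦ by
    rw [SModEq.zero, ← SModEq.sub_mem]
    have h := contract (hB n)
    rw [← Function.iterate_succ_apply' T] at h
    exact (h.symm.trans (hB (n + 1))).mono (Submodule.pow_smul_top_le I M n.le_succ)
  refine ⟨B, ?_⟩
  rw [sub_eq_zero] at hfix
  exact (eq_sub_iff_add_eq.mp hfix.symm)

end AdicFixedPoint

/-- The binomial expansion of `(1 + pⁿ X) ^ p`, with all terms of degree at least two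
divisible by `p ^ (n + 2)`. -/
theorem exists_one_add_pow_mul_X_pow_prime (R : Type*) [CommRing R] {p n : ℕ} (hp : p.Prime)
    (hp3 : 3 ≤ p) (hn : 1 ≤ n) :
    ∃ g : R[X], (1 + (p : R[X]) ^ n * X) ^ p
      = 1 + (p : R[X]) ^ (n + 1) * (X + (p : R[X]) * g) := by
  have term (k : ℕ) (hk : k ∈ Finset.range (p - 1)) :
      (p : R[X]) ^ (n + 2) ∣ ((p : R[X]) ^ n * X) ^ (k + 2) * (p.choose (k + 2) : R[X]) := by
    rw [Finset.mem_range] at hk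
    rw [mul_pow, ← pow_mul, mul_right_comm]
    refine Dvd.dvd.mul_right ?_ _
    rcases eq_or_ne (k + 2) p with h | h
    · refine Dvd.dvd.mul_right (pow_dvd_pow _ ?_) _
      rw [h]
      nlinarith
    · have hc : (p : R[X]) ∣ (p.choose (k + 2) : R[X]) :=
        Nat.cast_dvd_cast (hp.dvd_choose_self (by omega) (by omega))
      rw [pow_succ]
      exact mul_dvd_mul (pow_dvd_pow _ (by nlinarith)) hc
  obtain ⟨g, hg⟩ := Finset.dvd_sum term
  refine ⟨g, ?_⟩
  have hp1 : p + 1 = p - 1 + 1 + 1 := by omega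
  rw [add_comm 1, add_pow, hp1, Finset.sum_range_succ', Finset.sum_range_succ']
  simp only [one_pow, mul_one, add_assoc, one_add_one_eq_two, zero_add, pow_one, pow_zero,
    Nat.choose_one_right, Nat.choose_zero_right, Nat.cast_one, hg]
  ring

/-- Every element of `1 + p^{n+1} M₂(O)` is a `p`-th power of an element of
`1 + p^n M₂(O)`. -/
theorem stmt3 (p : ℕ) [Fact p.Prime] (hp : 5 ≤ p) (n : ℕ) (hn : 1 ≤ n)
    (A : Matrix (Fin 2) (Fin 2) (Oram p)) :
    ∃ B : Matrix (Fin 2) (Fin 2) (Oram p),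
      (1 + ((p : Oram p) ^ n) • B) ^ p = 1 + ((p : Oram p) ^ (n + 1)) • A := by
  have hmonic : (X ^ 2 - C (p : ℤ_[p])).Monic := monic_X_pow_sub_C _ two_ne_zero
  have : Module.Finite ℤ_[p] (Oram p) := hmonic.finite_adjoinRoot
  have : Module.Free ℤ_[p] (Oram p) := hmonic.free_adjoinRoot
  let I := IsLocalRing.maximalIdeal ℤ_[p]
  have : IsPrecomplete I (Matrix (Fin 2) (Fin 2) (Oram p)) :=
    (Module.Free.chooseBasis ℤ_[p] _).isPrecomplete I
  have : IsAdicComplete I (Matrix (Fin 2) (Fin 2) (Oram p)) := {}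
  have hpI : (p : ℤ_[p]) ∈ I := by
    rw [IsLocalRing.mem_maximalIdeal]
    exact PadicInt.p_nonunit
  obtain ⟨g, hg⟩ := exists_one_add_pow_mul_X_pow_prime ℤ_[p] (Fact.out : p.Prime)
    (by omega : 3 ≤ p) hn
  obtain ⟨B, hB⟩ := exists_add_smul_aeval_eq hpI g A
  refine ⟨B, ?_⟩
  have h := congrArg (aeval B) hg
  simp only [map_pow, map_add, map_one, map_mul, map_natCast, aeval_X] at h
  simp only [← Nat.cast_pow, Nat.cast_smul_eq_nsmul, nsmul_eq_mul] at hB h ⊢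
  rw [h, hB]
end

section
/- For every natural number n ≥ 1, the set of p-th powers of elements of 1 + pⁿM₂(O) equals 1 + p^{n+1}M₂(O); that is, {x^p : x ∈ M₂(O), x − 1 ∈ pⁿM₂(O)} = {y ∈ M₂(O) : y − 1 ∈ p^{n+1}M₂(O)}. -/
open Polynomial

/-- A finite module over an `I`-adically precomplete ring is `I`-adically precomplete. -/
theorem IsPrecomplete.of_moduleFinite {R M : Type*} [CommRing R] [AddCommGroup M] [Module R M]
    (I : Ideal R) [IsPrecomplete I R] [Module.Finite R M] : IsPrecomplete I M := by
  rw [← AdicCompletion.of_surjective_iff]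
  intro x
  obtain ⟨t, rfl⟩ := AdicCompletion.ofTensorProduct_surjective_of_finite I M x
  induction t with
  | zero => exact ⟨0, by simp⟩
  | add s t hs ht =>
    obtain ⟨a, ha⟩ := hs
    obtain ⟨b, hb⟩ := ht
    exact ⟨a + b, by rw [map_add, map_add, ha, hb]⟩
  | tmul r m =>
    obtain ⟨r, rfl⟩ := AdicCompletion.of_surjective I R r
    refine ⟨r • m, ?_⟩
    rw [AdicCompletion.ofTensorProduct_tmul]
    ext n
    rfl

theorem natCast_pow_smul_eq_mul {R A : Type*} [CommRing R] [Ring A] [Algebra R A]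
    (p k : ℕ) (a : A) : (p : R) ^ k • a = (p : A) ^ k * a := by
  rw [Algebra.smul_def, map_pow, map_natCast]

theorem smodEq_span_natCast_pow_iff {R A : Type*} [CommRing R] [Ring A] [Algebra R A]
    (p k : ℕ) (x y : A) :
    x ≡ y [SMOD (Ideal.span {(p : R)} ^ k • ⊤ : Submodule R A)] ↔ (p : A) ^ k ∣ x - y := by
  rw [SModEq.sub_mem, Ideal.span_singleton_pow, Submodule.ideal_span_singleton_smul,
    Submodule.mem_smul_pointwise_iff_exists]
  simp only [Submodule.mem_top, true_and, natCast_pow_smul_eq_mul]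
  exact ⟨fun ⟨c, hc⟩ => ⟨c, hc.symm⟩, fun ⟨c, hc⟩ => ⟨c, hc.symm⟩⟩

theorem dvd_aeval_sub_aeval_of_commute {A : Type*} [Ring A] {c x y : A}
    (hc : ∀ a, Commute c a) (h : c ∣ x - y) (g : ℤ[X]) : c ∣ aeval x g - aeval y g := by
  have mul_left (a b : A) (hb : c ∣ b) : c ∣ a * b := by
    obtain ⟨d, rfl⟩ := hb
    exact ⟨a * d, by rw [← mul_assoc, ← (hc a).eq, mul_assoc]⟩
  have pow_sub (n : ℕ) : c ∣ x ^ n - y ^ n := by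
    induction n with
    | zero => simp
    | succ n ih =>
      have : x ^ (n + 1) - y ^ (n + 1) = x ^ n * (x - y) + (x ^ n - y ^ n) * y := by
        rw [pow_succ, pow_succ]; noncomm_ring
      rw [this]
      exact dvd_add (mul_left _ _ h) (ih.mul_right y)
  induction g using Polynomial.induction_on' with
  | add f g hf hg =>
    rw [map_add, map_add, add_sub_add_comm]
    exact dvd_add hf hg
  | monomial n a =>
    rw [aeval_monomial, aeval_monomial, ← mul_sub]
    exact mul_left _ _ (pow_sub n)

theorem exists_one_add_prime_pow_mul_pow {S : Type*} [CommRing S] {p : ℕ} (hp : p.Prime)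
    (hp3 : 3 ≤ p) {n : ℕ} (hn : 1 ≤ n) (x : S) :
    ∃ g : S, (1 + (p : S) ^ n * x) ^ p = 1 + (p : S) ^ (n + 1) * (x + p * g) := by
  have tail : (p : S) ^ (n + 2) ∣
      ∑ k ∈ Finset.range (p - 1), ((p : S) ^ n * x) ^ (k + 2) * (p.choose (k + 2) : S) := by
    refine Finset.dvd_sum fun k hk => ?_
    rw [Finset.mem_range] at hk
    rw [mul_pow, ← pow_mul]
    rcases eq_or_ne (k + 2) p with h | h
    · refine Dvd.dvd.mul_right (Dvd.dvd.mul_right (pow_dvd_pow _ ?_) _) _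
      have : n * 3 ≤ n * (k + 2) := Nat.mul_le_mul_left n (by omega)
      omega
    · have hd : (p : S) ∣ (p.choose (k + 2) : S) :=
        Nat.cast_dvd_cast (hp.dvd_choose_self (by omega) (by omega))
      rw [show n + 2 = n + 1 + 1 from rfl, pow_succ]
      refine mul_dvd_mul (Dvd.dvd.mul_right (pow_dvd_pow _ ?_) _) hd
      have : n * 2 ≤ n * (k + 2) := Nat.mul_le_mul_left n (by omega)
      omega
  obtain ⟨g, hg⟩ := tail
  refine ⟨g, ?_⟩
  rw [add_comm 1, add_pow, show p + 1 = p - 1 + 1 + 1 by omega, Finset.sum_range_succ',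
    Finset.sum_range_succ']
  simp only [one_pow, mul_one, add_assoc, Nat.reduceAdd, hg]
  simp
  ring

/-- In a `p`-adically complete algebra, `T + p g(T) = b` is solvable. -/
theorem exists_add_natCast_mul_aeval_eq {R A : Type*} [CommRing R] [Ring A] [Algebra R A] (p : ℕ)
    [IsAdicComplete (Ideal.span {(p : R)}) A] (g : ℤ[X]) (b : A) :
    ∃ x : A, x + p * aeval x g = b := by
  have central (k : ℕ) (a : A) : Commute ((p : A) ^ k) a := (Nat.cast_commute p a).pow_left k
  let P : ℕ → ℤ[X] := fun k => Nat.rec X (fun _ q => X - (p : ℤ[X]) * g.comp q) k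
  have P_succ (k : ℕ) : P (k + 1) = X - (p : ℤ[X]) * g.comp (P k) := rfl
  let f : ℕ → A := fun k => aeval b (P k)
  have f_succ (k : ℕ) : f (k + 1) = b - p * aeval (f k) g := by
    simp [f, P_succ, aeval_comp]
  have step (k : ℕ) : (p : A) ^ k ∣ f (k + 1) - f k := by
    induction k with
    | zero => simp
    | succ k ih =>
      have : f (k + 1 + 1) - f (k + 1) = -(p * (aeval (f (k + 1)) g - aeval (f k) g)) := by
        rw [f_succ (k + 1), f_succ k]; noncomm_ring
      rw [this, dvd_neg, pow_succ']
      exact mul_dvd_mul_left _ (dvd_aeval_sub_aeval_of_commute (central k) ih g)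
  have cauchy {k l : ℕ} (hkl : k ≤ l) : (p : A) ^ k ∣ f k - f l := by
    induction l, hkl using Nat.le_induction with
    | base => simp
    | succ l hkl ih =>
      rw [← sub_sub_sub_cancel_right _ _ (f l)]
      exact dvd_sub ih ((pow_dvd_pow _ hkl).trans (step l))
  obtain ⟨x, hx⟩ := IsPrecomplete.prec (I := Ideal.span {(p : R)}) inferInstance
    fun {k l} hkl => (smodEq_span_natCast_pow_iff p k (f k) (f l)).2 (cauchy hkl)
  simp only [smodEq_span_natCast_pow_iff] at hx
  refine ⟨x, (IsHausdorff.eq_iff_smodEq (I := Ideal.span {(p : R)})).2 fun k => ?_⟩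
  rw [smodEq_span_natCast_pow_iff]
  have : x + p * aeval x g - b =
      (f k - f (k + 1)) - (f k - x) - p * (aeval (f k) g - aeval x g) := by
    rw [f_succ]; noncomm_ring
  rw [this]
  exact dvd_sub (dvd_sub (cauchy k.le_succ) (hx k))
    (by
      rw [(Nat.cast_commute p _).eq]
      exact (dvd_aeval_sub_aeval_of_commute (central k) (hx k) g).mul_right _)

/-- The `p`-th powers of the elements of `1 + pⁿA` are the elements of `1 + pⁿ⁺¹A`. -/
theorem exists_pow_eq_iff_of_isAdicComplete {R A : Type*} [CommRing R] [Ring A] [Algebra R A]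
    {p : ℕ} (hp : p.Prime) (hp3 : 3 ≤ p) [IsAdicComplete (Ideal.span {(p : R)}) A]
    {n : ℕ} (hn : 1 ≤ n) (y : A) :
    (∃ x : A, (p : A) ^ n ∣ x - 1 ∧ y = x ^ p) ↔ (p : A) ^ (n + 1) ∣ y - 1 := by
  obtain ⟨g, hg⟩ := exists_one_add_prime_pow_mul_pow hp hp3 hn (X : ℤ[X])
  have pow_eq (m : A) :
      (1 + (p : A) ^ n * m) ^ p = 1 + (p : A) ^ (n + 1) * (m + p * aeval m g) := by
    simpa using congrArg (aeval m) hg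
  constructor
  · rintro ⟨x, ⟨m, hm⟩, rfl⟩
    exact ⟨m + p * aeval m g, by rw [eq_add_of_sub_eq' hm, pow_eq, add_sub_cancel_left]⟩
  · rintro ⟨b, hb⟩
    obtain ⟨m, hm⟩ := exists_add_natCast_mul_aeval_eq (R := R) p g b
    exact ⟨1 + (p : A) ^ n * m, ⟨m, add_sub_cancel_left _ _⟩,
      by rw [pow_eq, hm, eq_add_of_sub_eq' hb]⟩

/-- The set of `p`-th powers of elements of `1 + p^n M₂(O)` equals
`1 + p^{n+1} M₂(O)`. -/
theorem stmt4 (p : ℕ) [Fact p.Prime] (hp : 5 ≤ p) (n : ℕ) (hn : 1 ≤ n) :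
    {y : Matrix (Fin 2) (Fin 2) (Oram p) |
        ∃ x : Matrix (Fin 2) (Fin 2) (Oram p),
          (∃ m : Matrix (Fin 2) (Fin 2) (Oram p), x - 1 = ((p : Oram p) ^ n) • m)
            ∧ y = x ^ p}
      = {y : Matrix (Fin 2) (Fin 2) (Oram p) |
          ∃ m : Matrix (Fin 2) (Fin 2) (Oram p),
            y - 1 = ((p : Oram p) ^ (n + 1)) • m} := by
  have : Module.Finite ℤ_[p] (Oram p) :=
    (monic_X_pow_sub_C (p : ℤ_[p]) two_ne_zero).finite_adjoinRoot
  have : Module.Finite ℤ_[p] (Matrix (Fin 2) (Fin 2) (Oram p)) :=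
    .trans (Oram p) _
  have : IsPrecomplete (IsLocalRing.maximalIdeal ℤ_[p]) (Matrix (Fin 2) (Fin 2) (Oram p)) :=
    .of_moduleFinite _
  have : IsAdicComplete (IsLocalRing.maximalIdeal ℤ_[p]) (Matrix (Fin 2) (Fin 2) (Oram p)) :=
    { toIsHausdorff := inferInstance, toIsPrecomplete := this }
  rw [PadicInt.maximalIdeal_eq_span_p] at this
  ext y
  simp only [Set.mem_ofPred_eq, natCast_pow_smul_eq_mul]
  exact exists_pow_eq_iff_of_isAdicComplete (R := ℤ_[p]) Fact.out (by omega) hn y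
end

section
/- Let p ≥ 5 be a prime and let c ∈ ℚ_p with n := v_p(c) ≥ 1. Then for all natural numbers N ≥ m ≥ 0, the p-adic valuation of c^{2N} · p^m · C(N,m) / (2N)! satisfies v_p(c^{2N} · p^m · C(N,m) / (2N)!) ≥ m · (2n + 1 − 2/(p−1)), as an inequality of rational numbers. -/
/-- Legendre's bound `v_p(k!) ≤ k / (p - 1)`. -/
theorem padicValNat_factorial_le_div (p : ℕ) [hp : Fact p.Prime] (k : ℕ) :
    (padicValNat p k.factorial : ℚ) ≤ k / (p - 1) := by
  have hp1 : (1 : ℚ) < p := by exact_mod_cast hp.out.one_lt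
  have h : (p - 1) * padicValNat p k.factorial ≤ k :=
    (sub_one_mul_padicValNat_factorial k).trans_le (Nat.sub_le _ _)
  rw [le_div_iff₀ (sub_pos.mpr hp1), mul_comm, ← Nat.cast_pred hp.out.pos]
  exact_mod_cast h

/-- For a prime `p ≥ 5` and `c ∈ ℚ_p` with `n = v_p(c) ≥ 1`, and all
`N ≥ m ≥ 0`: `v_p(c^{2N}·p^m·C(N,m)/(2N)!) ≥ m·(2n + 1 - 2/(p-1))`. -/
theorem stmt12 (p : ℕ) [Fact p.Prime] (hp : 5 ≤ p) (c : ℚ_[p])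
    (hn : 1 ≤ c.valuation) (N m : ℕ) (hm : m ≤ N) :
    (m : ℚ) * (2 * (c.valuation : ℚ) + 1 - 2 / (p - 1))
      ≤ ((c ^ (2 * N) * (p : ℚ_[p]) ^ m * (N.choose m : ℚ_[p])
            / ((2 * N).factorial : ℚ_[p])).valuation : ℚ) := by
  have hc : c ≠ 0 := by
    rintro rfl
    simp at hn
  have hp0 : (p : ℚ_[p]) ≠ 0 := Nat.cast_ne_zero.mpr (by lia)
  have hchoose : (N.choose m : ℚ_[p]) ≠ 0 := Nat.cast_ne_zero.mpr (Nat.choose_pos hm).ne'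
  have hfact : ((2 * N).factorial : ℚ_[p]) ≠ 0 := Nat.cast_ne_zero.mpr (Nat.factorial_ne_zero _)
  have hcN := pow_ne_zero (2 * N) hc
  have hpm := pow_ne_zero m hp0
  rw [div_eq_mul_inv _ ((2 * N).factorial : ℚ_[p]),
    Padic.valuation_mul (mul_ne_zero (mul_ne_zero hcN hpm) hchoose) (inv_ne_zero hfact),
    Padic.valuation_mul (mul_ne_zero hcN hpm) hchoose, Padic.valuation_mul hcN hpm,
    Padic.valuation_inv, Padic.valuation_pow, Padic.valuation_pow, Padic.valuation_p,
    Padic.valuation_natCast, Padic.valuation_natCast]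
  have hlegendre := padicValNat_factorial_le_div p (2 * N)
  push_cast at hlegendre ⊢
  simp only [padicValRat.of_nat, Int.cast_natCast]
  have hp5 : (5 : ℚ) ≤ p := by exact_mod_cast hp
  have hinv : 1 / ((p : ℚ) - 1) ≤ 1 := by
    rw [div_le_one] <;> linarith
  have hn' : (1 : ℚ) ≤ c.valuation := by exact_mod_cast hn
  have hm' : (m : ℚ) ≤ N := by exact_mod_cast hm
  have hgap : 0 ≤ ((N : ℚ) - m) * (c.valuation - 1 / ((p : ℚ) - 1)) :=
    mul_nonneg (by linarith) (by linarith)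
  have hchoose_nonneg : (0 : ℚ) ≤ padicValNat p (N.choose m) := Nat.cast_nonneg _
  rw [div_eq_mul_one_div] at hlegendre ⊢
  linarith
end
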